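/- arXiv:2306.05549 — 3 statements merged into one kernel-verified Lean document; each statement's English description precedes it below -/
import Mathlib

section
/- Let N ≥ 2 be an even integer, k = N/2, and let f : [0,1) → [0,∞) be continuous with f(0) = 0 and f(r) > 0 for r ∈ (0,1), satisfying limsup_{r→0⁺} f(r)·|ln r|^σ < ∞ for some σ > 1. Then sup { ∫₀¹ r^{N−1} exp(μ_N |v(r)|^{(N+2)/N + f(r)}) dr : v ∈ X_1, ‖v‖_{X_1} = 1 } > (1/N)·(1 + e^{H_k}), where H_k = ∑_{i=1}^{k} 1/i. -/
open MeasureTheory Real Set Filter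
open scoped ENNReal

/-- Surface area of the unit sphere in `ℝ^N` (equals `N` times the volume of the unit ball). -/
noncomputable def omegaS (N : ℕ) : ℝ :=
  N * (volume (Metric.ball (0 : EuclideanSpace ℝ (Fin N)) 1)).toReal

/-- The normalising constant `c_N = ω_{N-1} · binom(N,k) / N`. -/
noncomputable def cN (N k : ℕ) : ℝ := omegaS N * (N.choose k) / N

/-- The critical constant `μ_N = N · (ω_{N-1} · binom(N-1,k-1) / k)^{2/N}`. -/
noncomputable def muN (N k : ℕ) : ℝ :=
  N * (omegaS N * ((N - 1).choose (k - 1)) / k) ^ ((2 : ℝ) / N)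

/-- Membership in the weighted space `X₁`: `v` is locally absolutely continuous on `(0,1)`
with derivative `v'` (in the sense of the fundamental theorem of calculus),
`v(r) → 0` as `r → 1⁻`, and the two defining weighted integrals are finite. -/
structure MemX1 (N k : ℕ) (v v' : ℝ → ℝ) : Prop where
  locAC : ∀ a ∈ Ioo (0:ℝ) 1, ∀ b ∈ Ioo (0:ℝ) 1,
    IntervalIntegrable v' volume a b ∧ v b - v a = ∫ t in a..b, v' t
  lim_one : Tendsto v (nhdsWithin 1 (Iio 1)) (nhds 0)
  grad_int : ∫⁻ r in Ioo (0:ℝ) 1, ENNReal.ofReal (r ^ (N - k) * |v' r| ^ (k + 1)) < ⊤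
  fun_int : ∫⁻ r in Ioo (0:ℝ) 1, ENNReal.ofReal (r ^ (N - 1) * |v r| ^ (k + 1)) < ⊤

/-- The norm on `X₁`: `‖v‖ = (c_N ∫₀¹ r^{N-k} |v'|^{k+1} dr)^{1/(k+1)}`. -/
noncomputable def normX1 (N k : ℕ) (v' : ℝ → ℝ) : ℝ :=
  (cN N k * ∫ r in Ioo (0:ℝ) 1, r ^ (N - k) * |v' r| ^ (k + 1)) ^ (1 / (k + 1 : ℝ))

/-- The supercritical Trudinger–Moser integral `∫₀¹ r^{N-1} exp(β |v|^{(N+2)/N + f(r)}) dr`. -/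
noncomputable def mtIntegral (N : ℕ) (β : ℝ) (f v : ℝ → ℝ) : ℝ≥0∞ :=
  ∫⁻ r in Ioo (0:ℝ) 1,
    ENNReal.ofReal (r ^ (N - 1) * exp (β * |v r| ^ (((N : ℝ) + 2) / N + f r)))

/-- For a nonnegative continuous derivative, the lower Lebesgue integral over an open interval is
the increment of the antiderivative. -/
lemma lintegral_Ioo_eq_sub_of_hasDerivAt {a b : ℝ} (hab : a ≤ b) {F g : ℝ → ℝ}
    (hF : ∀ x ∈ Icc a b, HasDerivAt F (g x) x) (hg : ContinuousOn g (Icc a b))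
    (hg0 : ∀ x ∈ Icc a b, 0 ≤ g x) :
    ∫⁻ x in Ioo a b, ENNReal.ofReal (g x) = ENNReal.ofReal (F b - F a) := by
  have hint : IntervalIntegrable g volume a b :=
    ContinuousOn.intervalIntegrable (by rwa [uIcc_of_le hab])
  have h := intervalIntegral.integral_eq_sub_of_hasDerivAt
    (fun x hx => hF x (by rwa [uIcc_of_le hab] at hx)) hint
  rw [← h, intervalIntegral.integral_of_le hab, integral_Ioc_eq_integral_Ioo,
    ofReal_integral_eq_lintegral_ofReal]
  · exact ((intervalIntegrable_iff_integrableOn_Ioo_of_le hab).1 hint)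
  · exact (ae_restrict_iff' measurableSet_Ioo).2
      (ae_of_all _ fun x hx => hg0 x (Ioo_subset_Icc_self hx))

lemma hasDerivAt_one_add_mul_sq (q r : ℝ) :
    HasDerivAt (fun r : ℝ => 1 + q * r ^ 2) (2 * q * r) r := by
  refine (((hasDerivAt_pow 2 r).const_mul q).const_add 1).congr_deriv ?_
  norm_num
  ring

lemma hasDerivAt_log_one_add_mul_sq {q : ℝ} (hq : 0 < q) (r : ℝ) :
    HasDerivAt (fun r : ℝ => log (1 + q * r ^ 2)) (2 * q * r / (1 + q * r ^ 2)) r :=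
  (hasDerivAt_one_add_mul_sq q r).log (by positivity)

lemma hasDerivAt_bubble_mass {k : ℕ} (hk : 0 < k) {q : ℝ} (hq : 0 < q) (r : ℝ) :
    HasDerivAt (fun r : ℝ => (r ^ 2 / (1 + q * r ^ 2)) ^ k / (2 * k))
      (r ^ (2 * k - 1) / (1 + q * r ^ 2) ^ (k + 1)) r := by
  have hpos : 0 < 1 + q * r ^ 2 := by positivity
  have h := ((((hasDerivAt_pow 2 r).fun_div (hasDerivAt_one_add_mul_sq q r) hpos.ne').fun_pow
    k).div_const (2 * (k : ℝ)))
  refine h.congr_deriv ?_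
  obtain ⟨j, rfl⟩ : ∃ j, k = j + 1 := ⟨k - 1, by omega⟩
  have e : 2 * (j + 1) - 1 = 2 * j + 1 := by omega
  have hj : ((j : ℝ) + 1) ≠ 0 := by positivity
  rw [e]
  push_cast
  simp only [div_pow]
  field_simp
  norm_num
  ring

lemma hasDerivAt_bubble_energy (k : ℕ) {q : ℝ} (hq : 0 < q) (r : ℝ) :
    HasDerivAt (fun r : ℝ => log (1 + q * r ^ 2) -
        ∑ i ∈ Finset.range k, (q * r ^ 2 / (1 + q * r ^ 2)) ^ (i + 1) / (i + 1))
      (2 * q ^ (k + 1) * r ^ (2 * k + 1) / (1 + q * r ^ 2) ^ (k + 1)) r := by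
  have hpos : 0 < 1 + q * r ^ 2 := by positivity
  have hz := (((hasDerivAt_pow 2 r).const_mul q).fun_div (hasDerivAt_one_add_mul_sq q r) hpos.ne')
  induction k with
  | zero => simpa using hasDerivAt_log_one_add_mul_sq hq r
  | succ k ih =>
    have h := ih.fun_sub ((hz.fun_pow (k + 1)).div_const ((k : ℝ) + 1))
    simp only [Finset.sum_range_succ, ← sub_sub]
    refine h.congr_deriv ?_
    have hk : ((k : ℝ) + 1) ≠ 0 := by positivity
    push_cast
    simp only [div_pow]
    field_simp
    norm_num
    ring

lemma lintegral_Ioo_zero_one_split {ρ : ℝ} (h0 : 0 < ρ) (h1 : ρ < 1) (h : ℝ → ℝ≥0∞) :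
    ∫⁻ r in Ioo 0 1, h r = (∫⁻ r in Ioo 0 ρ, h r) + ∫⁻ r in Ioo ρ 1, h r := by
  rw [← Ioc_union_Ioo_eq_Ioo h0.le h1, lintegral_union measurableSet_Ioo
    (Set.disjoint_left.2 fun x hx hx' => absurd hx'.1 (not_lt.2 hx.2)),
    restrict_Ioo_eq_restrict_Ioc (a := 0)]

/-- A truncated logarithm, capped near the origin by the Liouville-type bubble. -/
noncomputable def bubbleProfile (k : ℕ) (m q ρ r : ℝ) : ℝ :=
  if r ≤ ρ then m - k * log (1 + q * r ^ 2) else -(2 * k * log r)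

/-- The derivative of `bubbleProfile` away from the gluing radius. -/
noncomputable def bubbleSlope (k : ℕ) (q ρ r : ℝ) : ℝ :=
  if r ≤ ρ then -(2 * k * q * r / (1 + q * r ^ 2)) else -(2 * k / r)

lemma measurable_bubbleSlope (k : ℕ) (q ρ : ℝ) : Measurable (bubbleSlope k q ρ) := by
  unfold bubbleSlope
  exact Measurable.ite measurableSet_Iic (by fun_prop) (by fun_prop)

lemma abs_bubbleSlope_le (k : ℕ) {q r : ℝ} (hq : 0 < q) (ρ : ℝ) (hr : 0 < r) :
    |bubbleSlope k q ρ r| ≤ 2 * k / r := by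
  unfold bubbleSlope
  split_ifs
  · rw [abs_neg, abs_of_nonneg (by positivity), div_le_div_iff₀ (by positivity) hr]
    nlinarith [show (0 : ℝ) ≤ k from k.cast_nonneg]
  · rw [abs_neg, abs_of_nonneg (by positivity)]

lemma continuousOn_bubbleProfile (k : ℕ) {m q ρ : ℝ} (hq : 0 < q)
    (hm : m - k * log (1 + q * ρ ^ 2) = -(2 * k * log ρ)) :
    ContinuousOn (bubbleProfile k m q ρ) (Ioi 0) := by
  unfold bubbleProfile
  refine ContinuousOn.if ?_ ?_ ?_
  · rintro x ⟨-, hx⟩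
    have : x = ρ := by simpa using frontier_Iic_subset _ hx
    rw [this, hm]
  · refine Continuous.continuousOn ?_
    exact continuous_const.sub (continuous_const.mul
      (Continuous.log (by fun_prop) fun x => by positivity))
  · refine ContinuousOn.mono (s := Ioi 0) ?_ inter_subset_left
    exact ((continuousOn_const.mul (continuousOn_log.mono fun x hx => ne_of_gt hx))).neg

lemma hasDerivAt_bubbleProfile (k : ℕ) {m q ρ r : ℝ} (hq : 0 < q) (hr : 0 < r) (hrρ : r ≠ ρ) :
    HasDerivAt (bubbleProfile k m q ρ) (bubbleSlope k q ρ r) r := by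
  rcases lt_or_gt_of_ne hrρ with h | h
  · have h1 := ((hasDerivAt_log_one_add_mul_sq hq r).const_mul (k : ℝ)).const_sub m
    refine (h1.congr_deriv ?_).congr_of_eventuallyEq ?_
    · simp only [bubbleSlope, h.le, if_true]
      ring
    · filter_upwards [Iio_mem_nhds h] with x hx
      simp [bubbleProfile, (mem_Iio.1 hx).le]
  · have h1 := ((hasDerivAt_log hr.ne').const_mul (2 * (k : ℝ))).fun_neg
    refine (h1.congr_deriv ?_).congr_of_eventuallyEq ?_
    · simp only [bubbleSlope, not_le.2 h, if_false]
      ring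
    · filter_upwards [Ioi_mem_nhds h] with x hx
      simp [bubbleProfile, mem_Ioi.1 hx]

lemma lintegral_bubbleSlope (k : ℕ) {q ρ : ℝ} (hq : 0 < q) (h0 : 0 < ρ) (h1 : ρ < 1) :
    ∫⁻ r in Ioo 0 1, ENNReal.ofReal (r ^ k * |bubbleSlope k q ρ r| ^ (k + 1)) =
      ENNReal.ofReal ((2 * k) ^ k * (k * (log (1 + q * ρ ^ 2) - ∑ i ∈ Finset.range k,
        (q * ρ ^ 2 / (1 + q * ρ ^ 2)) ^ (i + 1) / (i + 1)) - 2 * k * log ρ)) := by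
  rcases Nat.eq_zero_or_pos k with rfl | hk
  · simp [bubbleSlope]
  have hin : ∫⁻ r in Ioo 0 ρ, ENNReal.ofReal (r ^ k * |bubbleSlope k q ρ r| ^ (k + 1)) =
      ENNReal.ofReal ((2 * k) ^ k * k * (log (1 + q * ρ ^ 2) - ∑ i ∈ Finset.range k,
        (q * ρ ^ 2 / (1 + q * ρ ^ 2)) ^ (i + 1) / (i + 1))) := by
    have := lintegral_Ioo_eq_sub_of_hasDerivAt h0.le
      (fun x _ => (hasDerivAt_bubble_energy k hq x).const_mul ((2 * (k : ℝ)) ^ k * k))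
      (Continuous.continuousOn (continuous_const.mul
        (Continuous.div (by fun_prop) (by fun_prop) fun x => by positivity)))
      (fun x hx => by have := hx.1; positivity)
    simp only [ne_eq, OfNat.ofNat_ne_zero, not_false_eq_true, zero_pow, mul_zero, add_zero,
      log_one, zero_div, Nat.add_eq_zero_iff, one_ne_zero, and_false, Finset.sum_const_zero,
      sub_zero] at this
    rw [← this]
    refine setLIntegral_congr_fun measurableSet_Ioo fun r hr => ?_
    have hr0 := hr.1
    simp only [bubbleSlope, hr.2.le, if_true, abs_neg]
    rw [abs_of_nonneg (by positivity), div_pow]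
    congr 1
    field_simp
    ring
  have hout : ∫⁻ r in Ioo ρ 1, ENNReal.ofReal (r ^ k * |bubbleSlope k q ρ r| ^ (k + 1)) =
      ENNReal.ofReal ((2 * k) ^ k * -(2 * k * log ρ)) := by
    have := lintegral_Ioo_eq_sub_of_hasDerivAt h1.le
      (fun x hx => (hasDerivAt_log (h0.trans_le hx.1).ne').const_mul ((2 * (k : ℝ)) ^ (k + 1)))
      (continuousOn_const.mul (continuousOn_inv₀.mono fun x hx => (h0.trans_le hx.1).ne'))
      (fun x hx => by have := h0.trans_le hx.1; positivity)
    rw [show (2 * (k : ℝ)) ^ k * -(2 * k * log ρ) =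
      (2 * (k : ℝ)) ^ (k + 1) * log 1 - (2 * (k : ℝ)) ^ (k + 1) * log ρ by rw [log_one]; ring,
      ← this]
    refine setLIntegral_congr_fun measurableSet_Ioo fun r hr => ?_
    have hr0 := h0.trans hr.1
    simp only [bubbleSlope, not_le.2 hr.1, if_false, abs_neg]
    rw [abs_of_nonneg (by positivity), div_pow]
    congr 1
    field_simp
    ring
  rw [lintegral_Ioo_zero_one_split h0 h1, hin, hout, ← ENNReal.ofReal_add]
  · congr 1
    ring
  · have hmono := (monotoneOn_of_deriv_nonneg (convex_Ici (0 : ℝ))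
      (fun x _ => (hasDerivAt_bubble_energy k hq x).continuousAt.continuousWithinAt)
      (fun x _ => (hasDerivAt_bubble_energy k hq x).differentiableAt.differentiableWithinAt)
      (fun x hx => by
        rw [interior_Ici] at hx
        have := mem_Ioi.1 hx
        rw [(hasDerivAt_bubble_energy k hq x).deriv]
        positivity)) (mem_Ici.2 le_rfl) (mem_Ici.2 h0.le) h0.le
    simp only [ne_eq, OfNat.ofNat_ne_zero, not_false_eq_true, zero_pow, mul_zero, add_zero,
      log_one, zero_div, Nat.add_eq_zero_iff, one_ne_zero, and_false, Finset.sum_const_zero,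
      sub_zero] at hmono
    positivity
  · have := log_neg h0 h1
    have : 0 ≤ -(2 * k * log ρ) := by
      rw [← mul_neg]
      exact mul_nonneg (by positivity) (by linarith)
    positivity

lemma memX1_bubbleProfile {k : ℕ} (hk : 0 < k) {m q ρ : ℝ} (hq : 0 < q) (h0 : 0 < ρ) (h1 : ρ < 1)
    (hm : m - k * log (1 + q * ρ ^ 2) = -(2 * k * log ρ)) (c : ℝ) :
    MemX1 (2 * k) k (fun r => c * bubbleProfile k m q ρ r) (fun r => c * bubbleSlope k q ρ r) := by
  have hlogρ := log_neg h0 h1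
  have e : 2 * k - k = k := by omega
  constructor
  · intro a ha b hb
    have hpos : ∀ x ∈ uIcc a b, 0 < x := fun x hx => (lt_min ha.1 hb.1).trans_le hx.1
    have hint : IntervalIntegrable (fun r => c * bubbleSlope k q ρ r) volume a b := by
      refine IntervalIntegrable.const_mul ?_ c
      have : IntervalIntegrable (fun r => 2 * (k : ℝ) / r) volume a b :=
        ContinuousOn.intervalIntegrable
          (continuousOn_const.div continuousOn_id fun x hx => (hpos x hx).ne')
      refine this.mono_fun (measurable_bubbleSlope k q ρ).aestronglyMeasurable ?_
      refine (ae_restrict_iff' measurableSet_uIoc).2 (ae_of_all _ fun x hx => ?_)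
      have hx0 := hpos x (uIoc_subset_uIcc hx)
      simp only [norm_eq_abs]
      rw [abs_of_nonneg (a := 2 * (k : ℝ) / x) (by positivity)]
      exact abs_bubbleSlope_le k hq ρ hx0
    refine ⟨hint, ?_⟩
    refine (MeasureTheory.integral_eq_of_hasDerivAt_off_countable
      (fun r => c * bubbleProfile k m q ρ r) _ (countable_singleton ρ) ?_ ?_ hint).symm
    · exact continuousOn_const.mul ((continuousOn_bubbleProfile k hq hm).mono hpos)
    · exact fun x hx => (hasDerivAt_bubbleProfile k hq
        (hpos x (Ioo_subset_Icc_self hx.1)) hx.2).const_mul c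
  · have : Tendsto (fun r => c * bubbleProfile k m q ρ r) (nhds 1)
        (nhds (c * bubbleProfile k m q ρ 1)) :=
      (hasDerivAt_bubbleProfile k hq one_pos h1.ne').continuousAt.const_mul c
    rw [show c * bubbleProfile k m q ρ 1 = 0 by simp [bubbleProfile, h1]] at this
    exact this.mono_left nhdsWithin_le_nhds
  · simp only [e, abs_mul, mul_pow, mul_left_comm _ (|c| ^ (k + 1))]
    simp_rw [ENNReal.ofReal_mul (show 0 ≤ |c| ^ (k + 1) by positivity)]
    rw [lintegral_const_mul' _ _ ENNReal.ofReal_ne_top, lintegral_bubbleSlope k hq h0 h1]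
    exact ENNReal.mul_lt_top ENNReal.ofReal_lt_top ENNReal.ofReal_lt_top
  · have hbound : ∀ r ∈ Ioo (0 : ℝ) 1, |bubbleProfile k m q ρ r| ≤ m := by
      intro r hr
      have hr0 := hr.1
      have hk0 : (0 : ℝ) < k := by exact_mod_cast hk
      have hL : 0 ≤ log (1 + q * ρ ^ 2) := log_nonneg (by nlinarith [sq_nonneg ρ])
      unfold bubbleProfile
      split_ifs with h
      · have h2 : log (1 + q * r ^ 2) ≤ log (1 + q * ρ ^ 2) :=
          log_le_log (by positivity) (by gcongr)
        have h3 : 0 ≤ log (1 + q * r ^ 2) := log_nonneg (by nlinarith [sq_nonneg r])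
        rw [abs_of_nonneg] <;> nlinarith
      · have h2 := log_neg hr.1 hr.2
        have h3 := log_lt_log h0 (not_le.1 h)
        rw [abs_of_nonneg] <;> nlinarith
    calc ∫⁻ r in Ioo (0 : ℝ) 1, ENNReal.ofReal
          (r ^ (2 * k - 1) * |c * bubbleProfile k m q ρ r| ^ (k + 1))
        ≤ ∫⁻ r in Ioo (0 : ℝ) 1, ENNReal.ofReal ((|c| * m) ^ (k + 1)) := by
          refine setLIntegral_mono' measurableSet_Ioo fun r hr => ENNReal.ofReal_le_ofReal ?_
          rw [abs_mul, ← one_mul ((|c| * m) ^ (k + 1))]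
          have := hbound r hr
          have := hr.1.le
          gcongr
          exact pow_le_one₀ hr.1.le hr.2.le
      _ < ⊤ := by simp

lemma omegaS_pos {N : ℕ} (hN : 0 < N) : 0 < omegaS N := by
  have : 0 < (volume (Metric.ball (0 : EuclideanSpace ℝ (Fin N)) 1)).toReal :=
    ENNReal.toReal_pos (Metric.measure_ball_pos _ _ one_pos).ne' measure_ball_lt_top.ne
  unfold omegaS
  positivity

lemma cN_pos {k : ℕ} (hk : 0 < k) : 0 < cN (2 * k) k := by
  have h1 := omegaS_pos (N := 2 * k) (by omega)
  have h2 : (0 : ℝ) < (2 * k).choose k := by exact_mod_cast Nat.choose_pos (by omega)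
  unfold cN
  positivity

lemma muN_eq {k : ℕ} (hk : 0 < k) :
    muN (2 * k) k = (cN (2 * k) k * (2 * k) ^ k) ^ (1 / k : ℝ) := by
  have h1 := omegaS_pos (N := 2 * k) (by omega)
  have h2 : cN (2 * k) k = omegaS (2 * k) * ((2 * k - 1).choose (k - 1)) / k := by
    obtain ⟨j, rfl⟩ : ∃ j, k = j + 1 := ⟨k - 1, by omega⟩
    have h3 := Nat.add_one_mul_choose_eq (2 * j + 1) j
    have h4 : ((2 * j + 1 + 1 : ℕ) : ℝ) * (2 * j + 1).choose j =
        (2 * j + 1 + 1).choose (j + 1) * ((j + 1 : ℕ) : ℝ) := by exact_mod_cast h3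
    have e1 : 2 * (j + 1) = 2 * j + 1 + 1 := by ring
    have e2 : 2 * j + 1 + 1 - 1 = 2 * j + 1 := by omega
    unfold cN
    rw [e1, e2, Nat.add_sub_cancel, mul_div_assoc, mul_div_assoc]
    congr 1
    rw [div_eq_div_iff (by positivity) (by positivity), ← h4]
    ring
  have hk0 : (k : ℝ) ≠ 0 := by positivity
  rw [mul_rpow (cN_pos hk).le (by positivity), ← rpow_natCast (2 * (k : ℝ)) k,
    ← rpow_mul (by positivity), mul_one_div_cancel hk0, rpow_one, h2]
  unfold muN
  push_cast
  rw [mul_comm, show (2 : ℝ) / (2 * k) = 1 / k by field_simp]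

/-- Tangent line bound for the exponent of the Trudinger–Moser functional along a normalised
profile. -/
lemma tangent_le_muN_mul_rpow {k : ℕ} (hk : 0 < k) {B t e : ℝ} (hB : 0 < B) (ht : 0 < t)
    (he : 0 ≤ e)
    (h1 : 1 ≤ (cN (2 * k) k * (2 * k) ^ k * B) ^ (-(1 / (k + 1 : ℝ))) * t) :
    B + (k + 1) / k * (t - B) ≤ muN (2 * k) k *
      ((cN (2 * k) k * (2 * k) ^ k * B) ^ (-(1 / (k + 1 : ℝ))) * t) ^
        ((((2 * k : ℕ) : ℝ) + 2) / (2 * k : ℕ) + e) := by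
  have hc := cN_pos hk
  have hk0 : (0 : ℝ) < k := by exact_mod_cast hk
  rw [muN_eq hk]
  set D := cN (2 * k) k * (2 * k) ^ k with hD
  have hDpos : 0 < D := by positivity
  have hP : (((2 * k : ℕ) : ℝ) + 2) / (2 * k : ℕ) = (k + 1) / k := by
    push_cast
    field_simp
  have hP1 : (1 : ℝ) ≤ (k + 1) / k := by
    rw [le_div_iff₀ hk0]
    linarith
  have hbern : 1 + (k + 1) / k * (t / B - 1) ≤ (1 + (t / B - 1)) ^ ((k + 1) / k : ℝ) :=
    one_add_mul_self_le_rpow_one_add (by linarith [div_pos ht hB]) hP1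
  calc B + (k + 1) / k * (t - B) = B * (1 + (k + 1) / k * (t / B - 1)) := by field_simp
    _ ≤ B * (1 + (t / B - 1)) ^ ((k + 1) / k : ℝ) := by gcongr
    _ = D ^ (1 / k : ℝ) * ((D * B) ^ (-(1 / (k + 1 : ℝ))) * t) ^ ((k + 1) / k : ℝ) := by
      rw [add_sub_cancel, mul_rpow (by positivity) ht.le, ← rpow_mul (by positivity),
        div_rpow ht.le hB.le,
        show -(1 / ((k : ℝ) + 1)) * ((k + 1) / k) = -(1 / k) by field_simp,
        mul_rpow hDpos.le hB.le, show ((k : ℝ) + 1) / k = 1 + 1 / k by field_simp,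
        rpow_add hB, rpow_one, rpow_neg hDpos.le, rpow_neg hB.le]
      have := rpow_pos_of_pos hDpos (1 / k : ℝ)
      have := rpow_pos_of_pos hB (1 / k : ℝ)
      field_simp
    _ ≤ _ := by
      rw [hP]
      gcongr
      linarith

lemma normX1_bubbleProfile {k : ℕ} (hk : 0 < k) {q ρ B : ℝ} (hq : 0 < q) (h0 : 0 < ρ) (h1 : ρ < 1)
    (hB : 0 < B)
    (hE : k * (log (1 + q * ρ ^ 2) - ∑ i ∈ Finset.range k,
        (q * ρ ^ 2 / (1 + q * ρ ^ 2)) ^ (i + 1) / (i + 1)) - 2 * k * log ρ = B) :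
    normX1 (2 * k) k (fun r =>
      (cN (2 * k) k * (2 * k) ^ k * B) ^ (-(1 / (k + 1 : ℝ))) * bubbleSlope k q ρ r) = 1 := by
  have hc := cN_pos hk
  have hk0 : (0 : ℝ) < k := by exact_mod_cast hk
  have e : 2 * k - k = k := by omega
  have hI : ∫ r in Ioo (0 : ℝ) 1, r ^ k * |bubbleSlope k q ρ r| ^ (k + 1) = (2 * k) ^ k * B := by
    rw [integral_eq_lintegral_of_nonneg_ae, lintegral_bubbleSlope k hq h0 h1, hE,
      ENNReal.toReal_ofReal (by positivity)]
    · exact (ae_restrict_iff' measurableSet_Ioo).2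
        (ae_of_all _ fun x hx => by have := hx.1; positivity)
    · have := measurable_bubbleSlope k q ρ
      exact (Measurable.mul (by fun_prop) (this.abs.pow_const _)).aestronglyMeasurable
  unfold normX1
  simp only [e, abs_mul, mul_pow, mul_left_comm _ (|_| ^ (k + 1))]
  simp only [← mul_pow]
  rw [integral_const_mul, hI, abs_of_pos (by positivity), ← rpow_natCast, ← rpow_mul (by positivity),
    show -(1 / ((k : ℝ) + 1)) * ((k + 1 : ℕ) : ℝ) = -1 by push_cast; field_simp, rpow_neg_one]
  have : (cN (2 * k) k * (2 * k) ^ k * B) ≠ 0 := by positivity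
  rw [mul_left_comm, ← mul_assoc (cN _ _), inv_mul_cancel₀ this, one_rpow]

lemma le_lintegral_bubble {k : ℕ} (hk : 0 < k) {B h q ρ : ℝ} (hB : 0 < B) (hh : 0 ≤ h)
    (hq : 0 < q) (hqρ : 1 + q * ρ ^ 2 = exp (B / (2 * k)))
    (hρ : ρ = exp (-((B / 2 + k * h) / (2 * k)))) (hρ1 : ρ < 1) {f : ℝ → ℝ}
    (hf : ∀ r ∈ Ico (0 : ℝ) 1, 0 ≤ f r)
    (hlarge : 1 ≤ (cN (2 * k) k * (2 * k) ^ k * B) ^ (-(1 / (k + 1 : ℝ))) * (B / 2)) :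
    ENNReal.ofReal (exp h / (2 * k)) ≤ ∫⁻ r in Ioo 0 ρ, ENNReal.ofReal (r ^ (2 * k - 1) *
      exp (muN (2 * k) k * |(cN (2 * k) k * (2 * k) ^ k * B) ^ (-(1 / (k + 1 : ℝ))) *
        bubbleProfile k (B + k * h) q ρ r| ^ ((((2 * k : ℕ) : ℝ) + 2) / (2 * k : ℕ) + f r))) := by
  have hk0 : (0 : ℝ) < k := by exact_mod_cast hk
  have hc := cN_pos hk
  have hρ0 : 0 < ρ := hρ ▸ exp_pos _
  have hval : exp h / (2 * k) = exp (B + (k + 1) * h) * ((ρ ^ 2 / (1 + q * ρ ^ 2)) ^ k / (2 * k)) -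
      exp (B + (k + 1) * h) * (((0 : ℝ) ^ 2 / (1 + q * 0 ^ 2)) ^ k / (2 * k)) := by
    rw [hqρ, hρ, ← exp_nat_mul, ← exp_sub, ← exp_nat_mul]
    simp only [ne_eq, OfNat.ofNat_ne_zero, not_false_eq_true, zero_pow, zero_div, hk.ne', mul_zero,
      sub_zero]
    rw [← mul_div_assoc, ← exp_add]
    congr 2
    push_cast
    field_simp
    ring
  rw [hval, ← lintegral_Ioo_eq_sub_of_hasDerivAt hρ0.le
    (fun x _ => (hasDerivAt_bubble_mass hk hq x).const_mul (exp (B + (k + 1) * h)))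
    (Continuous.continuousOn (continuous_const.mul
      (Continuous.div (by fun_prop) (by fun_prop) fun x => by positivity)))
    (fun x hx => by have := hx.1; positivity)]
  refine setLIntegral_mono' measurableSet_Ioo fun r hr => ENNReal.ofReal_le_ofReal ?_
  have hr0 := hr.1
  have hpos : 0 < 1 + q * r ^ 2 := by positivity
  have hlog : log (1 + q * r ^ 2) ≤ B / (2 * k) := by
    rw [← log_exp (B / (2 * k)), ← hqρ]
    exact log_le_log hpos (by have := hr.2.le; gcongr)
  have hτ : bubbleProfile k (B + k * h) q ρ r = B + k * h - k * log (1 + q * r ^ 2) := by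
    simp [bubbleProfile, hr.2.le]
  have hτ2 : B / 2 ≤ bubbleProfile k (B + k * h) q ρ r := by
    have h1 : k * log (1 + q * r ^ 2) ≤ k * (B / (2 * k)) := by gcongr
    have h2 : k * (B / (2 * k)) = B / 2 := by field_simp
    have h3 : 0 ≤ k * h := by positivity
    rw [hτ]
    linarith
  have htan := tangent_le_muN_mul_rpow hk hB (show 0 < bubbleProfile k (B + k * h) q ρ r by linarith)
    (hf r ⟨hr0.le, hr.2.trans hρ1⟩) (hlarge.trans (by gcongr))
  have hexp : exp (B + (k + 1) * h) * (r ^ (2 * k - 1) / (1 + q * r ^ 2) ^ (k + 1)) =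
      r ^ (2 * k - 1) * exp (B + (k + 1) / k * (bubbleProfile k (B + k * h) q ρ r - B)) := by
    have : B + (k + 1) / k * (bubbleProfile k (B + k * h) q ρ r - B) =
        B + (k + 1) * h - ((k + 1 : ℕ) : ℝ) * log (1 + q * r ^ 2) := by
      rw [hτ]
      push_cast
      field_simp
      ring
    rw [this, exp_sub, exp_nat_mul, exp_log hpos]
    ring
  rw [hexp, abs_of_pos (by have : 0 < bubbleProfile k (B + k * h) q ρ r := by linarith
                           positivity)]
  gcongr

lemma le_lintegral_log {k : ℕ} (hk : 0 < k) {c m q ρ F : ℝ} (hρ0 : 0 < ρ) (hρ : ρ < 1 / 4)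
    (hc : 0 < c) (hc1 : c * (2 * k * log 2) ≤ 1) {f : ℝ → ℝ}
    (hf : ∀ r ∈ Ico (0 : ℝ) 1, 0 ≤ f r) (hF : ∀ r ∈ Icc (1 / 4 : ℝ) (1 / 2), f r ≤ F) :
    ENNReal.ofReal ((1 - ρ ^ (2 * k)) / (2 * k) + (1 / 4) ^ (2 * k) * (muN (2 * k) k *
      (c * (2 * k * log 2)) ^ (((k : ℝ) + 1) / k + F))) ≤
      ∫⁻ r in Ioo ρ 1, ENNReal.ofReal (r ^ (2 * k - 1) * exp (muN (2 * k) k *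
        |c * bubbleProfile k m q ρ r| ^ ((((2 * k : ℕ) : ℝ) + 2) / (2 * k : ℕ) + f r))) := by
  have hk0 : (0 : ℝ) < k := by exact_mod_cast hk
  have hμ : 0 < muN (2 * k) k := by
    rw [muN_eq hk]
    have := cN_pos hk
    positivity
  have hlog2 : 0 < log 2 := log_pos one_lt_two
  have hP : (((2 * k : ℕ) : ℝ) + 2) / (2 * k : ℕ) = (k + 1) / k := by
    push_cast
    field_simp
  set κ := muN (2 * k) k * (c * (2 * k * log 2)) ^ (((k : ℝ) + 1) / k + F) with hκ
  have hκ0 : 0 ≤ κ := by positivity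
  have hbase : ∫⁻ r in Ioo ρ 1, ENNReal.ofReal (r ^ (2 * k - 1)) =
      ENNReal.ofReal ((1 - ρ ^ (2 * k)) / (2 * k)) := by
    rw [lintegral_Ioo_eq_sub_of_hasDerivAt (F := fun r => r ^ (2 * k) / (2 * k)) (by linarith)
      (fun x _ => ?_) (by fun_prop) (fun x hx => pow_nonneg (hρ0.le.trans hx.1) _)]
    · rw [one_pow, sub_div]
    · refine ((hasDerivAt_pow (2 * k) x).div_const _).congr_deriv ?_
      push_cast
      field_simp
  have hgain : ∫⁻ r in Ioo ρ 1,
      (Ioo (1 / 4 : ℝ) (1 / 2)).indicator (fun _ => ENNReal.ofReal ((1 / 4) ^ (2 * k - 1) * κ)) r =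
      ENNReal.ofReal ((1 / 4) ^ (2 * k) * κ) := by
    rw [lintegral_indicator measurableSet_Ioo, Measure.restrict_restrict measurableSet_Ioo,
      Set.inter_eq_left.2 (Ioo_subset_Ioo hρ.le (by norm_num)), lintegral_const,
      Measure.restrict_apply_univ, Real.volume_Ioo, ← ENNReal.ofReal_mul (by positivity)]
    congr 1
    obtain ⟨j, rfl⟩ : ∃ j, k = j + 1 := ⟨k - 1, by omega⟩
    rw [show 2 * (j + 1) = 2 * j + 1 + 1 by ring, Nat.add_sub_cancel, pow_succ _ (2 * j + 1)]
    ring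
  have hρk : ρ ^ (2 * k) ≤ 1 := pow_le_one₀ hρ0.le (by linarith)
  rw [ENNReal.ofReal_add (div_nonneg (by linarith) (by positivity)) (by positivity), ← hbase,
    ← hgain, ← lintegral_add_left (by fun_prop)]
  refine setLIntegral_mono' measurableSet_Ioo fun r hr => ?_
  have hr0 : 0 < r := hρ0.trans hr.1
  have hτ : bubbleProfile k m q ρ r = 2 * k * -log r := by
    simp [bubbleProfile, hr.1]
  have hlogr := log_neg hr0 hr.2
  have hv : 0 ≤ c * bubbleProfile k m q ρ r := by
    rw [hτ]
    have : 0 ≤ -log r := by linarith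
    positivity
  rw [abs_of_nonneg hv, hP]
  by_cases hmem : r ∈ Ioo (1 / 4 : ℝ) (1 / 2)
  · rw [indicator_of_mem hmem, ← ENNReal.ofReal_add (by positivity) (by positivity)]
    refine ENNReal.ofReal_le_ofReal ?_
    have hlower : c * (2 * k * log 2) ≤ c * bubbleProfile k m q ρ r := by
      rw [hτ, ← log_inv]
      gcongr
      rw [le_inv_comm₀ two_pos hr0]
      linarith [hmem.2]
    have hfr := hf r ⟨hr0.le, hr.2⟩
    have hpow : κ ≤ muN (2 * k) k * (c * bubbleProfile k m q ρ r) ^ (((k : ℝ) + 1) / k + f r) := by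
      rw [hκ]
      refine mul_le_mul_of_nonneg_left ?_ hμ.le
      calc (c * (2 * k * log 2)) ^ (((k : ℝ) + 1) / k + F)
          ≤ (c * (2 * k * log 2)) ^ (((k : ℝ) + 1) / k + f r) :=
            rpow_le_rpow_of_exponent_ge (by positivity) hc1
              (by linarith [hF r (Ioo_subset_Icc_self hmem)])
        _ ≤ _ := rpow_le_rpow (by positivity) hlower (by positivity)
    calc r ^ (2 * k - 1) + (1 / 4) ^ (2 * k - 1) * κ ≤ r ^ (2 * k - 1) * (κ + 1) := by
          have : (1 / 4 : ℝ) ^ (2 * k - 1) * κ ≤ r ^ (2 * k - 1) * κ := by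
            have := hmem.1.le
            gcongr
          linarith
      _ ≤ _ := by
          gcongr
          linarith [add_one_le_exp (muN (2 * k) k *
            (c * bubbleProfile k m q ρ r) ^ (((k : ℝ) + 1) / k + f r))]
  · rw [indicator_of_notMem hmem, add_zero]
    refine ENNReal.ofReal_le_ofReal (le_mul_of_one_le_right (by positivity) (one_le_exp ?_))
    positivity

/-- The truncated harmonic sum tends to the full one at the rate of the truncation. -/
lemma exp_harmonic_sub_le (k : ℕ) {Z : ℝ} (hZ0 : 0 ≤ Z) :
    exp (∑ i ∈ Finset.range k, (1 : ℝ) / (i + 1)) -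
        exp (∑ i ∈ Finset.range k, Z ^ (i + 1) / (i + 1)) ≤
      exp (∑ i ∈ Finset.range k, (1 : ℝ) / (i + 1)) * (k * (1 - Z)) := by
  have hsum : ∑ i ∈ Finset.range k, (1 : ℝ) / (i + 1) -
      ∑ i ∈ Finset.range k, Z ^ (i + 1) / (i + 1) ≤ k * (1 - Z) := by
    rw [← Finset.sum_sub_distrib]
    refine (Finset.sum_le_card_nsmul _ _ (1 - Z) fun i _ => ?_).trans (by simp)
    rw [← sub_div, div_le_iff₀ (by positivity)]
    have := one_add_mul_le_pow (a := Z - 1) (by linarith) (i + 1)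
    push_cast at this
    rw [add_sub_cancel] at this
    linarith
  set H := ∑ i ∈ Finset.range k, (1 : ℝ) / (i + 1)
  set h := ∑ i ∈ Finset.range k, Z ^ (i + 1) / (i + 1 : ℝ)
  have h1 := add_one_le_exp (h - H)
  have h2 : exp h = exp H * exp (h - H) := by rw [← exp_add]; congr 1; ring
  rw [h2]
  nlinarith [exp_pos H]

lemma eventually_one_le_mul_rpow {D p : ℝ} (hD : 0 < D) (hp : p < 1) :
    ∀ᶠ B : ℝ in atTop, 1 ≤ (D * B) ^ (-p) * (B / 2) := by
  have h := (tendsto_rpow_atTop (sub_pos.2 hp)).const_mul_atTop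
    (show 0 < D ^ (-p) / 2 by positivity)
  filter_upwards [h.eventually_ge_atTop 1, eventually_gt_atTop 0] with B h1 hB
  refine h1.trans_eq ?_
  rw [mul_rpow hD.le hB.le, sub_eq_neg_add, rpow_add hB, rpow_one]
  ring

lemma tendsto_mul_rpow_neg_atTop {D p : ℝ} (hD : 0 < D) (hp : 0 < p) :
    Tendsto (fun B : ℝ => (D * B) ^ (-p)) atTop (nhds 0) :=
  (tendsto_rpow_neg_atTop hp).comp (tendsto_id.const_mul_atTop hD)

lemma eventually_mul_exp_neg_lt_mul_rpow {D A b p q c C : ℝ} (hD : 0 < D) (hb : 0 < b)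
    (hc : 0 < c) (hC : 0 < C) :
    ∀ᶠ B : ℝ in atTop, A * exp (-b * B) < C * ((D * B) ^ (-p) * c) ^ q := by
  have h := (tendsto_rpow_mul_exp_neg_mul_atTop_nhds_zero (p * q) b hb).const_mul A
  rw [mul_zero] at h
  have hpos : 0 < C * (D ^ (-p * q) * c ^ q) := by positivity
  filter_upwards [h.eventually_lt_const hpos, eventually_gt_atTop 0] with B h1 hB
  rw [mul_rpow (by positivity) hc.le, ← rpow_mul (by positivity), mul_rpow hD.le hB.le]
  have h2 : 0 < B ^ (-p * q) := rpow_pos_of_pos hB _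
  have h3 : B ^ (p * q) * B ^ (-p * q) = 1 := by
    rw [← rpow_add hB]
    simp
  calc A * exp (-b * B) = A * (B ^ (p * q) * exp (-b * B)) * B ^ (-p * q) := by
        linear_combination (-(A * exp (-b * B))) * h3
    _ < C * (D ^ (-p * q) * c ^ q) * B ^ (-p * q) := by gcongr
    _ = _ := by ring

theorem stmt12 (N k : ℕ) (hk : 0 < k) (hN : N = 2 * k)
    (f : ℝ → ℝ) (hfc : ContinuousOn f (Ico 0 1)) (hf0 : f 0 = 0)
    (hfpos : ∀ r ∈ Ioo (0:ℝ) 1, 0 < f r) (hfnn : ∀ r ∈ Ico (0:ℝ) 1, 0 ≤ f r)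
    (hσ : ∃ σ : ℝ, 1 < σ ∧ IsBoundedUnder (· ≤ ·) (nhdsWithin (0:ℝ) (Ioi 0))
      (fun r => f r * |log r| ^ σ))
    :
    ENNReal.ofReal (((1 : ℝ) / N) * (1 + exp (∑ i ∈ Finset.range k, (1 : ℝ) / (i + 1)))) <
      ⨆ p : {p : (ℝ → ℝ) × (ℝ → ℝ) // MemX1 N k p.1 p.2 ∧ normX1 N k p.2 = 1},
        mtIntegral N (muN N k) f p.1.1 := by
  subst hN
  have hk0 : (0 : ℝ) < k := by exact_mod_cast hk
  have hc := cN_pos hk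
  set D := cN (2 * k) k * (2 * (k : ℝ)) ^ k with hD
  have hD0 : 0 < D := by positivity
  have hμ : 0 < muN (2 * k) k := by
    rw [muN_eq hk]
    positivity
  have hlog2 : 0 < log 2 := log_pos one_lt_two
  obtain ⟨F, hF⟩ := isCompact_Icc.bddAbove_image
    (hfc.mono (show Icc (1 / 4 : ℝ) (1 / 2) ⊆ Ico 0 1 from
      fun x hx => ⟨by linarith [hx.1], by linarith [hx.2]⟩))
  have hF' : ∀ r ∈ Icc (1 / 4 : ℝ) (1 / 2), f r ≤ F := fun r hr => hF (mem_image_of_mem f hr)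
  set H := ∑ i ∈ Finset.range k, (1 : ℝ) / (i + 1)
  have hp0 : (0 : ℝ) < 1 / (k + 1) := by positivity
  have hp1 : (1 : ℝ) / (k + 1) < 1 := by
    rw [div_lt_one (by positivity)]
    linarith
  have hsmall : ∀ᶠ B : ℝ in atTop, exp (-(1 / (4 * k)) * B) < 1 / 4 :=
    (tendsto_exp_atBot.comp (tendsto_id.const_mul_atTop_of_neg
      (show -(1 / (4 * (k : ℝ))) < 0 by simpa using hk))).eventually_lt_const (by norm_num)
  have hlam : ∀ᶠ B : ℝ in atTop, (D * B) ^ (-(1 / (k + 1 : ℝ))) * (2 * k * log 2) < 1 := by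
    have h := (tendsto_mul_rpow_neg_atTop hD0 hp0).mul_const (2 * k * log 2)
    rw [zero_mul] at h
    exact h.eventually_lt_const one_pos
  obtain ⟨B, hB, hlarge, hlam, hsmall, hgain⟩ := ((eventually_gt_atTop (0 : ℝ)).and
    ((eventually_one_le_mul_rpow hD0 hp1).and
    (hlam.and (hsmall.and (eventually_mul_exp_neg_lt_mul_rpow (A := exp H * k + 1)
      (b := 1 / (2 * k)) (q := ((k : ℝ) + 1) / k + F) (p := 1 / (k + 1 : ℝ)) hD0 (by positivity)
      (show 0 < 2 * (k : ℝ) * log 2 by positivity)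
      (show 0 < 2 * (k : ℝ) * (1 / 4) ^ (2 * k) * muN (2 * k) k by positivity)))))).exists
  set Z := 1 - exp (-(B / (2 * k))) with hZ
  have hZ0 : 0 ≤ Z := by
    rw [hZ, sub_nonneg, exp_le_one_iff, neg_nonpos]
    positivity
  set h := ∑ i ∈ Finset.range k, Z ^ (i + 1) / (i + 1 : ℝ) with hh
  have hh0 : 0 ≤ h := Finset.sum_nonneg fun i _ => by positivity
  set ρ := exp (-((B / 2 + k * h) / (2 * k))) with hρ
  have hρ0 : 0 < ρ := exp_pos _
  have hρ4 : ρ < 1 / 4 := by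
    refine lt_of_le_of_lt (exp_le_exp.2 ?_) hsmall
    rw [neg_mul, neg_le_neg_iff, add_div, show B / 2 / (2 * k) = 1 / (4 * k) * B by
      field_simp; norm_num]
    have : 0 ≤ k * h / (2 * k) := by positivity
    linarith
  have hρ1 : ρ < 1 := by linarith
  set q := (exp (B / (2 * k)) - 1) / ρ ^ 2 with hq
  have hY : 1 < exp (B / (2 * k)) := one_lt_exp_iff.2 (by positivity)
  have hq0 : 0 < q := div_pos (sub_pos.2 hY) (by positivity)
  have hqρ' : q * ρ ^ 2 = exp (B / (2 * k)) - 1 := div_mul_cancel₀ _ (by positivity)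
  have hqρ : 1 + q * ρ ^ 2 = exp (B / (2 * k)) := by rw [hqρ']; ring
  have hZq : q * ρ ^ 2 / (1 + q * ρ ^ 2) = Z := by
    rw [hqρ, hqρ', hZ, exp_neg, sub_div, div_self (exp_pos _).ne', one_div]
  have hlogρ : log ρ = -((B / 2 + k * h) / (2 * k)) := log_exp _
  have hm : B + k * h - k * log (1 + q * ρ ^ 2) = -(2 * k * log ρ) := by
    rw [hqρ, log_exp, hlogρ]
    field_simp
    ring
  have hE : k * (log (1 + q * ρ ^ 2) - ∑ i ∈ Finset.range k,
      (q * ρ ^ 2 / (1 + q * ρ ^ 2)) ^ (i + 1) / (i + 1)) - 2 * k * log ρ = B := by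
    rw [hZq, ← hh, hqρ, log_exp, hlogρ]
    field_simp
    ring
  refine lt_of_lt_of_le ?_ (le_iSup_of_le
    ⟨(fun r => (D * B) ^ (-(1 / (k + 1 : ℝ))) * bubbleProfile k (B + k * h) q ρ r,
      fun r => (D * B) ^ (-(1 / (k + 1 : ℝ))) * bubbleSlope k q ρ r),
      memX1_bubbleProfile hk hq0 hρ0 hρ1 hm _, normX1_bubbleProfile hk hq0 hρ0 hρ1 hB hE⟩ le_rfl)
  unfold mtIntegral
  rw [lintegral_Ioo_zero_one_split hρ0 hρ1]
  refine lt_of_lt_of_le ?_ (add_le_add (le_lintegral_bubble hk hB hh0 hq0 hqρ hρ hρ1 hfnn hlarge)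
    (le_lintegral_log hk (m := B + k * h) (q := q) hρ0 hρ4 (by positivity) hlam.le hfnn hF'))
  have hρk : ρ ^ (2 * k) ≤ exp (-(1 / (2 * k)) * B) := by
    rw [hρ, ← exp_nat_mul, exp_le_exp]
    push_cast
    rw [show 2 * (k : ℝ) * -((B / 2 + k * h) / (2 * k)) = -(B / 2 + k * h) by field_simp,
      neg_mul, neg_le_neg_iff]
    have h1 : 1 / (2 * (k : ℝ)) ≤ 1 / 2 := by
      have : (1 : ℝ) ≤ k := by exact_mod_cast hk
      gcongr
      linarith
    have h2 : 0 ≤ k * h := by positivity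
    nlinarith
  have hρ2 : ρ ^ (2 * k) ≤ 1 := pow_le_one₀ hρ0.le hρ1.le
  have hexp := exp_harmonic_sub_le k hZ0
  rw [← hh, show 1 - Z = exp (-(1 / (2 * k)) * B) by rw [hZ]; ring_nf] at hexp
  have hdiv : 0 ≤ (1 - ρ ^ (2 * k)) / (2 * k) := div_nonneg (by linarith) (by positivity)
  rw [← ENNReal.ofReal_add (by positivity) (by positivity)]
  refine (ENNReal.ofReal_lt_ofReal_iff_of_nonneg (by positivity)).2 ?_
  have hk2 : (0 : ℝ) < 2 * k := by positivity
  rw [← mul_lt_mul_iff_right₀ hk2, mul_add (2 * (k : ℝ)), mul_add (2 * (k : ℝ)),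
    mul_div_cancel₀ _ hk2.ne', mul_div_cancel₀ _ hk2.ne']
  push_cast
  rw [← mul_assoc, mul_one_div_cancel hk2.ne', one_mul]
  linarith
end

section
/- Let N ≥ 2 be an even integer, k = N/2, and let v ∈ X_1 be a non-increasing function on (0,1). Then for every ϑ > 0 and every γ₀ > 0, lim_{r→0⁺} r^ϑ · |v(r)|^{2/N} · exp(γ₀ |v(r)|^{(N+2)/N}) = 0. -/
open MeasureTheory Real Set Filter
open scoped ENNReal

theorem abs_le_pow_div_add_div (k : ℕ) {s c : ℝ} (hs : 0 < s) (hc : 0 < c) (x : ℝ) :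
    |x| ≤ (c ^ k)⁻¹ * (s ^ k * |x| ^ (k + 1)) + c * s⁻¹ := by
  rcases le_total (s * |x|) c with h | h
  · have h1 : |x| ≤ c * s⁻¹ := by
      rw [← div_eq_mul_inv, le_div_iff₀ hs]; linarith
    have h2 : 0 ≤ (c ^ k)⁻¹ * (s ^ k * |x| ^ (k + 1)) := by positivity
    linarith
  · have h1 : |x| ≤ (c ^ k)⁻¹ * (s ^ k * |x| ^ (k + 1)) := by
      rw [inv_mul_eq_div, le_div_iff₀ (by positivity)]
      calc |x| * c ^ k ≤ |x| * (s * |x|) ^ k := by gcongr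
        _ = s ^ k * |x| ^ (k + 1) := by ring
    have h2 : 0 ≤ c * s⁻¹ := by positivity
    linarith

theorem abs_sub_le_of_lintegral_le (k : ℕ) {v v' : ℝ → ℝ} {r R c E : ℝ} (hr : 0 < r)
    (hrR : r ≤ R) (hc : 0 < c) (hE : 0 ≤ E)
    (hftc : v R - v r = ∫ t in r..R, v' t)
    (hen : ∫⁻ s in Ioc 0 R, ENNReal.ofReal (s ^ k * |v' s| ^ (k + 1)) ≤ ENNReal.ofReal E) :
    |v R - v r| ≤ (c ^ k)⁻¹ * E + c * log (R / r) := by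
  have hR : 0 < R := hr.trans_le hrR
  have hlog : 0 ≤ log (R / r) := log_nonneg ((one_le_div hr).2 hrR)
  have hint : IntervalIntegrable (fun s : ℝ => c * s⁻¹) volume r R := by
    refine (intervalIntegrable_inv_iff.2 (Or.inr ?_)).const_mul c
    rw [uIcc_of_le hrR]
    exact fun h => absurd h.1 (not_le.2 hr)
  have htail : ∫⁻ s in Ioc r R, ENNReal.ofReal (c * s⁻¹) = ENNReal.ofReal (c * log (R / r)) := by
    rw [← ofReal_integral_eq_lintegral_ofReal, ← intervalIntegral.integral_of_le hrR,
      intervalIntegral.integral_const_mul, integral_inv_of_pos hr hR]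
    · exact (intervalIntegrable_iff_integrableOn_Ioc_of_le hrR).1 hint
    · filter_upwards [ae_restrict_mem measurableSet_Ioc] with s hs
      have : 0 < s := hr.trans hs.1
      simp only [Pi.zero_apply]
      positivity
  have key : ENNReal.ofReal |v R - v r| ≤
      ENNReal.ofReal ((c ^ k)⁻¹ * E + c * log (R / r)) := by
    calc ENNReal.ofReal |v R - v r| = ‖∫ t in Ioc r R, v' t‖ₑ := by
          rw [hftc, intervalIntegral.integral_of_le hrR, ← Real.norm_eq_abs, ofReal_norm]
      _ ≤ ∫⁻ t in Ioc r R, ‖v' t‖ₑ := enorm_integral_le_lintegral_enorm _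
      _ ≤ ∫⁻ s in Ioc r R, (ENNReal.ofReal (c ^ k)⁻¹ *
            ENNReal.ofReal (s ^ k * |v' s| ^ (k + 1)) + ENNReal.ofReal (c * s⁻¹)) := by
          refine setLIntegral_mono' measurableSet_Ioc fun s hs => ?_
          have hs0 : 0 < s := hr.trans hs.1
          rw [← ofReal_norm, Real.norm_eq_abs, ← ENNReal.ofReal_mul (by positivity),
            ← ENNReal.ofReal_add (by positivity) (by positivity)]
          exact ENNReal.ofReal_le_ofReal (abs_le_pow_div_add_div k hs0 hc _)
      _ = ENNReal.ofReal (c ^ k)⁻¹ *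
            (∫⁻ s in Ioc r R, ENNReal.ofReal (s ^ k * |v' s| ^ (k + 1))) +
            ENNReal.ofReal (c * log (R / r)) := by
          rw [lintegral_add_right _ (by fun_prop), htail,
            lintegral_const_mul' _ _ ENNReal.ofReal_ne_top]
      _ ≤ ENNReal.ofReal (c ^ k)⁻¹ * ENNReal.ofReal E + ENNReal.ofReal (c * log (R / r)) := by
          gcongr
          exact (lintegral_mono_set (Ioc_subset_Ioc_left hr.le)).trans hen
      _ = _ := by
          rw [← ENNReal.ofReal_mul (by positivity), ENNReal.ofReal_add (by positivity)
            (by positivity)]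
  exact (ENNReal.ofReal_le_ofReal_iff (by positivity)).1 key

theorem exists_lintegral_Ioc_le {f : ℝ → ℝ≥0∞} (hf : ∫⁻ s in Ioo (0:ℝ) 1, f s < ⊤) {E : ℝ}
    (hE : 0 < E) : ∃ R ∈ Ioo (0:ℝ) 1, ∫⁻ s in Ioc 0 R, f s ≤ ENNReal.ofReal E := by
  obtain ⟨δ, hδ, h⟩ := exists_pos_setLIntegral_lt_of_measure_lt hf.ne
    (ε := ENNReal.ofReal E) (by simpa using hE)
  have hlim : Tendsto (fun R : ℝ => ENNReal.ofReal R) (nhdsWithin 0 (Ioi 0)) (nhds 0) := by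
    have := (ENNReal.continuous_ofReal.tendsto 0).mono_left (nhdsWithin_le_nhds (s := Ioi 0))
    simpa using this
  obtain ⟨R, hRδ, hR⟩ := ((hlim.eventually (gt_mem_nhds hδ)).and
    (Ioo_mem_nhdsGT (zero_lt_one' ℝ))).exists
  refine ⟨R, hR, ?_⟩
  have hsub : Ioc 0 R ⊆ Ioo (0:ℝ) 1 := fun s hs => ⟨hs.1, hs.2.trans_lt hR.2⟩
  have := h (Ioc 0 R) <| (Measure.restrict_apply_le _ _).trans_lt (by simpa using hRδ)
  rw [Measure.restrict_restrict measurableSet_Ioc, inter_eq_left.2 hsub] at this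
  exact this.le

/-- A function of finite energy `∫ r ^ k |v'| ^ (k + 1)` grows more slowly than
`(-log r) ^ (k / (k + 1))` at the origin. -/
theorem eventually_abs_rpow_le_log (k : ℕ) (hk : 0 < k) {v v' : ℝ → ℝ}
    (hac : ∀ a ∈ Ioo (0:ℝ) 1, ∀ b ∈ Ioo (0:ℝ) 1, v b - v a = ∫ t in a..b, v' t)
    (hen : ∫⁻ s in Ioo (0:ℝ) 1, ENNReal.ofReal (s ^ k * |v' s| ^ (k + 1)) < ⊤)
    {M : ℝ} (hM : 0 < M) :
    ∀ᶠ r in nhdsWithin (0:ℝ) (Ioi 0), |v r| ^ (((k : ℝ) + 1) / k) ≤ M * -log r := by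
  have hk' : (0:ℝ) < k := by exact_mod_cast hk
  obtain ⟨R, hR, hRE⟩ := exists_lintegral_Ioc_le hen (E := (M / 4) ^ k / 4) (by positivity)
  have hX : Tendsto (fun r => M * -log r) (nhdsWithin 0 (Ioi 0)) atTop :=
    (tendsto_neg_atBot_atTop.comp tendsto_log_nhdsGT_zero).const_mul_atTop hM
  have hY : Tendsto (fun r => (M * -log r) ^ ((k : ℝ) + 1)⁻¹) (nhdsWithin 0 (Ioi 0)) atTop :=
    (tendsto_rpow_atTop (by positivity)).comp hX
  have hYk := (tendsto_pow_atTop hk.ne').comp hY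
  filter_upwards [Ioo_mem_nhdsGT hR.1, hX.eventually_gt_atTop 0, hY.eventually_gt_atTop 0,
    hYk.eventually_ge_atTop (2 * |v R|)] with r hr hX0 hY0 hbig
  simp only [Function.comp_apply] at hbig
  set Y := (M * -log r) ^ ((k : ℝ) + 1)⁻¹ with hYdef
  have hYpow : Y ^ (k + 1) = M * -log r := by
    rw [hYdef, ← rpow_natCast, ← rpow_mul hX0.le]
    push_cast
    rw [inv_mul_cancel₀ (by positivity), rpow_one]
  have hosc := abs_sub_le_of_lintegral_le k (c := M / 4 / Y) hr.1 hr.2.le (by positivity)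
    (by positivity) (hac r ⟨hr.1, hr.2.trans hR.2⟩ R hR) hRE
  have h1 : ((M / 4 / Y) ^ k)⁻¹ * ((M / 4) ^ k / 4) = Y ^ k / 4 := by
    rw [div_pow]
    field_simp
  have h2 : M / 4 / Y * log (R / r) ≤ Y ^ k / 4 := by
    have hlog : log (R / r) ≤ -log r := by
      rw [log_div hR.1.ne' hr.1.ne']
      linarith [log_neg hR.1 hR.2]
    calc M / 4 / Y * log (R / r) ≤ M / 4 / Y * -log r := by gcongr
      _ = (M * -log r) / (4 * Y) := by field_simp
      _ = Y ^ k / 4 := by rw [← hYpow]; field_simp; ring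
  have hv : |v r| ≤ Y ^ k := by
    have := abs_sub_abs_le_abs_sub (v r) (v R)
    rw [abs_sub_comm] at this
    linarith
  calc |v r| ^ (((k : ℝ) + 1) / k) ≤ (Y ^ k) ^ (((k : ℝ) + 1) / k) := by gcongr
    _ = Y ^ (k + 1) := by
      rw [← rpow_natCast, ← rpow_natCast, ← rpow_mul hY0.le]
      congr 1
      push_cast
      field_simp
    _ = M * -log r := hYpow

theorem stmt17 (N k : ℕ) (hk : 0 < k) (hN : N = 2 * k) (v v' : ℝ → ℝ)
    (hv : MemX1 N k v v') (hmono : AntitoneOn v (Ioo 0 1))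
    (ϑ γ₀ : ℝ) (hϑ : 0 < ϑ) (hγ : 0 < γ₀) :
    Tendsto (fun r => r ^ ϑ * |v r| ^ ((2 : ℝ) / N) * exp (γ₀ * |v r| ^ (((N : ℝ) + 2) / N)))
      (nhdsWithin 0 (Ioi 0)) (nhds 0) := by
  subst hN
  have hk' : (0:ℝ) < k := by exact_mod_cast hk
  have e1 : (2:ℝ) / ((2 * k : ℕ) : ℝ) = 1 / k := by push_cast; field_simp
  have e2 : (((2 * k : ℕ) : ℝ) + 2) / ((2 * k : ℕ) : ℝ) = ((k : ℝ) + 1) / k := by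
    push_cast; field_simp
  rw [e1, e2]
  have hen := hv.grad_int
  rw [show 2 * k - k = k by omega] at hen
  have hgrowth := eventually_abs_rpow_le_log k hk (fun a ha b hb => (hv.locAC a ha b hb).2) hen
    (M := ϑ / (2 * (γ₀ + 1))) (by positivity)
  have hlim : Tendsto (fun r : ℝ => r ^ (ϑ / 2)) (nhdsWithin 0 (Ioi 0)) (nhds 0) := by
    have := ((continuousAt_rpow_const 0 (ϑ / 2) (Or.inr (by positivity))).tendsto).mono_left
      (nhdsWithin_le_nhds (s := Ioi (0:ℝ)))
    rwa [zero_rpow (by positivity)] at this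
  refine tendsto_of_tendsto_of_tendsto_of_le_of_le' tendsto_const_nhds hlim ?_ ?_
  · filter_upwards [self_mem_nhdsWithin] with r hr
    have : 0 < r := hr
    positivity
  · filter_upwards [hgrowth, self_mem_nhdsWithin] with r hgr hr
    have hr0 : 0 < r := hr
    set q := |v r| ^ (((k : ℝ) + 1) / k) with hq
    have hq0 : 0 ≤ q := by positivity
    have hpow : |v r| ^ (1 / (k : ℝ)) ≤ exp q := by
      refine le_trans ?_ (add_one_le_exp q)
      rcases le_total |v r| 1 with h | h
      · have := rpow_le_one (abs_nonneg (v r)) h (by positivity : 0 ≤ 1 / (k : ℝ))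
        linarith
      · have : |v r| ^ (1 / (k : ℝ)) ≤ q := rpow_le_rpow_of_exponent_le h (by gcongr; linarith)
        linarith
    have hbound : (γ₀ + 1) * q ≤ ϑ / 2 * -log r := by
      calc (γ₀ + 1) * q ≤ (γ₀ + 1) * (ϑ / (2 * (γ₀ + 1)) * -log r) := by gcongr
        _ = ϑ / 2 * -log r := by field_simp
    calc r ^ ϑ * |v r| ^ (1 / (k : ℝ)) * exp (γ₀ * q)
        ≤ r ^ ϑ * exp q * exp (γ₀ * q) := by gcongr
      _ = exp (log r * ϑ + q + γ₀ * q) := by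
        rw [rpow_def_of_pos hr0, exp_add, exp_add]
      _ ≤ exp (log r * (ϑ / 2)) := exp_le_exp.2 (by linarith)
      _ = r ^ (ϑ / 2) := (rpow_def_of_pos hr0 _).symm
end

section
/- Let N ≥ 2 be an even integer, k = N/2, and let f : [0,1) → [0,∞) be continuous with f(0) = 0 and f(r) > 0 for r ∈ (0,1), satisfying limsup_{r→0⁺} f(r)·|ln r|^σ < ∞ for some σ > 1. Then for each v ∈ X_1 there exists a constant c = c(v) > 0 such that sup_{r ∈ (0,1)} ((N+2)/N + f(r)) · |v(r)|^{f(r)} ≤ c. Moreover, the constant c can be chosen independently of v over all v ∈ X_1 with ‖v‖_{X_1} = 1. -/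
open MeasureTheory Real Set Filter
open scoped ENNReal

/-- A pointwise substitute for Young's inequality with exponents `k + 1` and `(k + 1) / k`. -/
lemma abs_le_div_add_inv_pow_mul (k : ℕ) {δ t : ℝ} (hδ : 0 < δ) (ht : 0 < t) (x : ℝ) :
    |x| ≤ δ * t⁻¹ + (δ ^ k)⁻¹ * (t ^ k * |x| ^ (k + 1)) := by
  rcases le_total (t * |x|) δ with h | h
  · have h1 : |x| ≤ δ * t⁻¹ := by
      rw [← div_eq_mul_inv, le_div_iff₀ ht]; linarith
    have h2 : 0 ≤ (δ ^ k)⁻¹ * (t ^ k * |x| ^ (k + 1)) := by positivity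
    linarith
  · have h1 : δ ^ k ≤ (t * |x|) ^ k := pow_le_pow_left₀ hδ.le h k
    have h2 : |x| ≤ (δ ^ k)⁻¹ * (t ^ k * |x| ^ (k + 1)) := by
      rw [inv_mul_eq_div, le_div_iff₀ (by positivity)]
      calc |x| * δ ^ k ≤ |x| * (t * |x|) ^ k := by gcongr
        _ = t ^ k * |x| ^ (k + 1) := by ring
    have h3 : 0 ≤ δ * t⁻¹ := by positivity
    linarith

lemma MemX1.aestronglyMeasurable {N k : ℕ} {v v' : ℝ → ℝ} (h : MemX1 N k v v') :
    AEStronglyMeasurable v' (volume.restrict (Ioo (0 : ℝ) 1)) := by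
  have hU : Ioo (0 : ℝ) 1 = ⋃ n : ℕ, Ioc (1 / ((n : ℝ) + 2)) (1 - 1 / ((n : ℝ) + 2)) := by
    ext x
    simp only [mem_Ioo, mem_iUnion, mem_Ioc]
    constructor
    · rintro ⟨h0, h1⟩
      obtain ⟨n, hn⟩ := exists_nat_one_div_lt (lt_min h0 (sub_pos.2 h1))
      have hle : 1 / ((n : ℝ) + 2) ≤ 1 / ((n : ℝ) + 1) := by gcongr; norm_num
      have := min_le_left x (1 - x)
      have := min_le_right x (1 - x)
      exact ⟨n, by linarith, by linarith⟩
    · rintro ⟨n, h0, h1⟩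
      have : 0 < 1 / ((n : ℝ) + 2) := by positivity
      exact ⟨by linarith, by linarith⟩
  rw [hU, aestronglyMeasurable_iUnion_iff]
  intro n
  have h0 : 0 < 1 / ((n : ℝ) + 2) := by positivity
  have h1 : 1 / ((n : ℝ) + 2) ≤ 1 / 2 := by
    gcongr; linarith [(Nat.cast_nonneg n : (0 : ℝ) ≤ n)]
  exact (h.locAC _ ⟨h0, by linarith⟩ (1 - 1 / ((n : ℝ) + 2))
    ⟨by linarith, by linarith⟩).1.1.aestronglyMeasurable

lemma MemX1.integrableOn_grad {N k : ℕ} {v v' : ℝ → ℝ} (h : MemX1 N k v v') :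
    IntegrableOn (fun r => r ^ (N - k) * |v' r| ^ (k + 1)) (Ioo (0 : ℝ) 1) := by
  refine ⟨?_, ?_⟩
  · exact ((continuous_pow _).aestronglyMeasurable).mul (h.aestronglyMeasurable.norm.pow _)
  · rw [hasFiniteIntegral_iff_ofReal]
    · exact h.grad_int
    · filter_upwards [ae_restrict_mem measurableSet_Ioo] with r hr
      have := hr.1
      simp only [Pi.zero_apply]
      positivity

/-- A radial estimate: functions in `X₁` grow at most logarithmically at the origin. -/
lemma MemX1.abs_le {N k : ℕ} (hN : N = 2 * k) {v v' : ℝ → ℝ} (h : MemX1 N k v v')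
    {δ : ℝ} (hδ : 0 < δ) {r : ℝ} (hr : r ∈ Ioo (0 : ℝ) 1) :
    |v r| ≤ δ * (-log r) +
      (δ ^ k)⁻¹ * ∫ t in Ioo (0 : ℝ) 1, t ^ (N - k) * |v' t| ^ (k + 1) := by
  set I := ∫ t in Ioo (0 : ℝ) 1, t ^ (N - k) * |v' t| ^ (k + 1) with hI
  have hNk : N - k = k := by omega
  have hint := h.integrableOn_grad
  have key : ∀ b ∈ Ioo r 1, |v r| ≤ |v b| + (δ * (-log r) + (δ ^ k)⁻¹ * I) := by
    intro b hb
    have hb0 : 0 < b := hr.1.trans hb.1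
    obtain ⟨hv', hftc⟩ := h.locAC r hr b ⟨hb0, hb.2⟩
    have hsub : Ioc r b ⊆ Ioo (0 : ℝ) 1 := fun t ht => ⟨hr.1.trans ht.1, ht.2.trans_lt hb.2⟩
    have hg : IntervalIntegrable (fun t => t ^ (N - k) * |v' t| ^ (k + 1)) volume r b :=
      (intervalIntegrable_iff_integrableOn_Ioc_of_le hb.1.le).2 (hint.mono_set hsub)
    have hz : (0 : ℝ) ∉ uIcc r b := by
      rw [uIcc_of_le hb.1.le]; exact fun h0 => absurd h0.1 (not_le.2 hr.1)
    have hinv : IntervalIntegrable (fun t : ℝ => t⁻¹) volume r b :=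
      intervalIntegral.intervalIntegrable_inv (fun t ht h0 => hz (h0 ▸ ht)) continuousOn_id
    have hgI : ∫ t in r..b, t ^ (N - k) * |v' t| ^ (k + 1) ≤ I := by
      rw [intervalIntegral.integral_of_le hb.1.le]
      refine setIntegral_mono_set hint ?_ hsub.eventuallyLE
      filter_upwards [ae_restrict_mem measurableSet_Ioo] with t ht
      have := ht.1
      simp only [Pi.zero_apply]
      positivity
    have hlog : ∫ t in r..b, t⁻¹ ≤ -log r := by
      rw [integral_inv hz, log_div hb0.ne' hr.1.ne']
      linarith [log_nonpos hb0.le hb.2.le]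
    have habs : |v b - v r| ≤ δ * (-log r) + (δ ^ k)⁻¹ * I := by
      rw [hftc]
      calc |∫ t in r..b, v' t| ≤ ∫ t in r..b, |v' t| :=
            intervalIntegral.abs_integral_le_integral_abs hb.1.le
        _ ≤ ∫ t in r..b, (δ * t⁻¹ + (δ ^ k)⁻¹ * (t ^ (N - k) * |v' t| ^ (k + 1))) := by
            refine intervalIntegral.integral_mono_on hb.1.le hv'.abs
              ((hinv.const_mul _).add (hg.const_mul _)) fun t ht => ?_
            rw [hNk]
            exact abs_le_div_add_inv_pow_mul k hδ (hr.1.trans_le ht.1) _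
        _ = δ * (∫ t in r..b, t⁻¹) +
              (δ ^ k)⁻¹ * ∫ t in r..b, t ^ (N - k) * |v' t| ^ (k + 1) := by
            rw [intervalIntegral.integral_add (hinv.const_mul _) (hg.const_mul _),
              intervalIntegral.integral_const_mul, intervalIntegral.integral_const_mul]
        _ ≤ _ := by gcongr
    have := abs_sub_abs_le_abs_sub (v r) (v b)
    rw [abs_sub_comm] at this
    linarith
  have hlim : Tendsto (fun b => |v b| + (δ * (-log r) + (δ ^ k)⁻¹ * I)) (nhdsWithin 1 (Iio 1))
      (nhds (|0| + (δ * (-log r) + (δ ^ k)⁻¹ * I))) := h.lim_one.abs.add_const _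
  rw [abs_zero, zero_add] at hlim
  refine ge_of_tendsto hlim ?_
  filter_upwards [Ioo_mem_nhdsLT hr.2] with b hb using key b hb

lemma mul_half_rpow_le {x : ℝ} : x * (1 / 2 : ℝ) ^ x ≤ 2 := by
  have h1 : x * log 2 + 1 ≤ (2 : ℝ) ^ x := by
    rw [rpow_def_of_pos two_pos, mul_comm (log 2)]; exact add_one_le_exp _
  have h2 : (0.6931471803 : ℝ) < log 2 := log_two_gt_d9
  have h3 : 0 < (2 : ℝ) ^ x := rpow_pos_of_pos two_pos _
  rw [one_div, inv_rpow two_pos.le, ← div_eq_mul_inv, div_le_iff₀ h3]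
  rcases le_total x 0 with hx | hx
  · linarith
  · nlinarith

/-- If `f` decays like `|log r|^{-σ}` at the origin, then a logarithmically growing quantity that
is small near `1`, raised to the power `f`, remains bounded on `(0,1)`. -/
lemma exists_bound_mul_log_rpow {f : ℝ → ℝ} (hfc : ContinuousOn f (Ico 0 1))
    (hfnn : ∀ r ∈ Ico (0 : ℝ) 1, 0 ≤ f r)
    (hσ : ∃ σ : ℝ, 1 < σ ∧ IsBoundedUnder (· ≤ ·) (nhdsWithin (0 : ℝ) (Ioi 0))
      (fun r => f r * |log r| ^ σ))
    {C δ : ℝ} (hC : 0 ≤ C) (hδ : 0 < δ) :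
    ∃ c > (0 : ℝ), ∀ r ∈ Ioo (0 : ℝ) 1, (C + f r) * (δ * (-log r) + 1 / 4) ^ f r ≤ c := by
  obtain ⟨σ, hσ1, M₀, hM₀⟩ := hσ
  rw [eventually_map] at hM₀
  have hlog0 : ∀ᶠ r in nhdsWithin (0 : ℝ) (Ioi 0), log r ≤ -1 :=
    tendsto_log_nhdsGT_zero.eventually (eventually_le_atBot (-1))
  obtain ⟨a, ha0, ha⟩ := (mem_nhdsGT_iff_exists_Ioo_subset).1 (hM₀.and hlog0)
  have hlim1 : Tendsto (fun r => δ * (-log r) + 1 / 4) (nhds 1) (nhds (δ * (-log 1) + 1 / 4)) :=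
    (((continuousAt_log one_ne_zero).neg.const_mul δ).add_const _)
  have hev1 : ∀ᶠ r in nhdsWithin (1 : ℝ) (Iio 1), δ * (-log r) + 1 / 4 < 1 / 2 :=
    (hlim1.mono_left nhdsWithin_le_nhds).eventually_lt_const (by norm_num)
  obtain ⟨b, hb1, hb⟩ := (mem_nhdsLT_iff_exists_Ioo_subset).1 hev1
  simp only [mem_Ioi, mem_Iio] at ha0 hb1
  have hpos : ∀ r ∈ Ioo (0 : ℝ) 1, 0 < δ * (-log r) + 1 / 4 := fun r hr => by
    have := log_neg hr.1 hr.2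
    have : 0 < δ * (-log r) := mul_pos hδ (by linarith)
    linarith
  have ha'0 : 0 < min a (1 / 2) := lt_min ha0 (by norm_num)
  have hb'1 : max b (1 / 2) < 1 := max_lt hb1 (by norm_num)
  have hsub : Icc (min a (1 / 2)) (max b (1 / 2)) ⊆ Ioo (0 : ℝ) 1 := fun r hr =>
    ⟨ha'0.trans_le hr.1, hr.2.trans_lt hb'1⟩
  have hfc' : ContinuousOn f (Icc (min a (1 / 2)) (max b (1 / 2))) :=
    hfc.mono (hsub.trans Ioo_subset_Ico_self)
  have hcont : ContinuousOn (fun r => (C + f r) * (δ * (-log r) + 1 / 4) ^ f r)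
      (Icc (min a (1 / 2)) (max b (1 / 2))) := by
    refine (continuousOn_const.add hfc').mul (ContinuousOn.rpow ?_ hfc' ?_)
    · exact (continuousOn_const.mul (continuousOn_log.mono
        fun r hr => (hsub hr).1.ne').neg).add continuousOn_const
    · exact fun r hr => Or.inl (hpos r (hsub hr)).ne'
  obtain ⟨K, hK⟩ := isCompact_Icc.bddAbove_image hcont
  set M := max M₀ 0 with hM
  have hM0 : 0 ≤ M := le_max_right _ _
  refine ⟨max (max K (C + 2)) ((C + M) * exp (M * (δ + 1))) + 1, ?_, fun r hr => ?_⟩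
  · have : C + 2 ≤ max (max K (C + 2)) ((C + M) * exp (M * (δ + 1))) :=
      (le_max_right _ _).trans (le_max_left _ _)
    linarith
  refine le_trans ?_ (lt_add_one _).le
  have hf := hfnn r ⟨hr.1.le, hr.2⟩
  have hB := hpos r hr
  rcases lt_or_ge r (min a (1 / 2)) with hra | hra
  · refine le_trans ?_ (le_max_right _ _)
    obtain ⟨h1, h2⟩ := ha ⟨hr.1, hra.trans_le (min_le_left _ _)⟩
    have hL : 1 ≤ |log r| := by rw [abs_of_nonpos (by linarith)]; linarith
    have hLσ : |log r| ≤ |log r| ^ σ := self_le_rpow_of_one_le hL hσ1.le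
    have hfL : f r * |log r| ≤ M :=
      (mul_le_mul_of_nonneg_left hLσ hf).trans (h1.trans (le_max_left _ _))
    have hfM : f r ≤ M := (le_mul_of_one_le_right hf hL).trans hfL
    have hlogB : log (δ * (-log r) + 1 / 4) ≤ (δ + 1) * |log r| := by
      have := log_le_sub_one_of_pos hB
      rw [abs_of_nonpos (by linarith)]
      nlinarith
    gcongr
    rw [rpow_def_of_pos hB]
    refine exp_le_exp.2 ?_
    calc log (δ * (-log r) + 1 / 4) * f r ≤ (δ + 1) * |log r| * f r := by gcongr
      _ = f r * |log r| * (δ + 1) := by ring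
      _ ≤ M * (δ + 1) := by gcongr
  rcases le_or_gt r (max b (1 / 2)) with hrb | hrb
  · exact (hK ⟨r, ⟨hra, hrb⟩, rfl⟩).trans ((le_max_left _ _).trans (le_max_left _ _))
  · refine le_trans ?_ ((le_max_right _ _).trans (le_max_left _ _))
    have h1 : δ * (-log r) + 1 / 4 < 1 / 2 := hb ⟨(le_max_left _ _).trans_lt hrb, hr.2⟩
    calc (C + f r) * (δ * (-log r) + 1 / 4) ^ f r ≤ (C + f r) * (1 / 2 : ℝ) ^ f r := by gcongr
      _ = C * (1 / 2 : ℝ) ^ f r + f r * (1 / 2 : ℝ) ^ f r := by ring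
      _ ≤ C * 1 + 2 := by
          gcongr
          · exact rpow_le_one (by norm_num) (by norm_num) hf
          · exact mul_half_rpow_le
      _ = C + 2 := by ring

/-- The supremum bound, uniform over functions with bounded gradient integral. -/
lemma exists_uniform_bound {N k : ℕ} (hk : 0 < k) (hN : N = 2 * k)
    {f : ℝ → ℝ} (hfc : ContinuousOn f (Ico 0 1))
    (hfnn : ∀ r ∈ Ico (0 : ℝ) 1, 0 ≤ f r)
    (hσ : ∃ σ : ℝ, 1 < σ ∧ IsBoundedUnder (· ≤ ·) (nhdsWithin (0 : ℝ) (Ioi 0))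
      (fun r => f r * |log r| ^ σ))
    {J : ℝ} (hJ : 0 ≤ J) :
    ∃ c > (0 : ℝ), ∀ v v' : ℝ → ℝ, MemX1 N k v v' →
      (∫ r in Ioo (0 : ℝ) 1, r ^ (N - k) * |v' r| ^ (k + 1)) ≤ J →
        ∀ r ∈ Ioo (0 : ℝ) 1, (((N : ℝ) + 2) / N + f r) * |v r| ^ (f r) ≤ c := by
  have hδ : 0 < 4 * J + 1 := by linarith
  have hδk : 4 * J + 1 ≤ (4 * J + 1) ^ k := le_self_pow₀ (by linarith) hk.ne'
  have hC : 0 ≤ ((N : ℝ) + 2) / N := by positivity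
  obtain ⟨c, hc, hbound⟩ := exists_bound_mul_log_rpow hfc hfnn hσ hC hδ
  refine ⟨c, hc, fun v v' h hI r hr => le_trans ?_ (hbound r hr)⟩
  have hf := hfnn r ⟨hr.1.le, hr.2⟩
  have hquarter : ((4 * J + 1) ^ k)⁻¹ *
      (∫ t in Ioo (0 : ℝ) 1, t ^ (N - k) * |v' t| ^ (k + 1)) ≤ 1 / 4 := by
    rw [inv_mul_eq_div, div_le_iff₀ (by positivity)]
    linarith
  have hv := h.abs_le hN hδ hr
  gcongr
  linarith

theorem stmt18 (N k : ℕ) (hk : 0 < k) (hN : N = 2 * k)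
    (f : ℝ → ℝ) (hfc : ContinuousOn f (Ico 0 1)) (hf0 : f 0 = 0)
    (hfpos : ∀ r ∈ Ioo (0:ℝ) 1, 0 < f r) (hfnn : ∀ r ∈ Ico (0:ℝ) 1, 0 ≤ f r)
    (hσ : ∃ σ : ℝ, 1 < σ ∧ IsBoundedUnder (· ≤ ·) (nhdsWithin (0:ℝ) (Ioi 0))
      (fun r => f r * |log r| ^ σ))
    :
    (∀ v v' : ℝ → ℝ, MemX1 N k v v' → ∃ c > (0:ℝ), ∀ r ∈ Ioo (0:ℝ) 1,
        (((N : ℝ) + 2) / N + f r) * |v r| ^ (f r) ≤ c) ∧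
      ∃ c > (0:ℝ), ∀ v v' : ℝ → ℝ, MemX1 N k v v' → normX1 N k v' = 1 →
        ∀ r ∈ Ioo (0:ℝ) 1, (((N : ℝ) + 2) / N + f r) * |v r| ^ (f r) ≤ c := by
  have hnonneg : ∀ v' : ℝ → ℝ,
      0 ≤ ∫ r in Ioo (0 : ℝ) 1, r ^ (N - k) * |v' r| ^ (k + 1) := fun v' =>
    setIntegral_nonneg measurableSet_Ioo fun r hr => by have := hr.1; positivity
  have hcN : 0 ≤ cN N k := by unfold cN omegaS; positivity
  constructor
  · intro v v' h
    obtain ⟨c, hc, hbound⟩ := exists_uniform_bound hk hN hfc hfnn hσ (hnonneg v')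
    exact ⟨c, hc, hbound v v' h le_rfl⟩
  · obtain ⟨c, hc, hbound⟩ := exists_uniform_bound hk hN hfc hfnn hσ (inv_nonneg.2 hcN)
    refine ⟨c, hc, fun v v' h hnorm => hbound v v' h ?_⟩
    have hone : cN N k * (∫ r in Ioo (0 : ℝ) 1, r ^ (N - k) * |v' r| ^ (k + 1)) = 1 :=
      (rpow_left_inj (mul_nonneg hcN (hnonneg v')) zero_le_one
        (by positivity : 1 / (k + 1 : ℝ) ≠ 0)).1 (hnorm.trans (one_rpow _).symm)
    exact (eq_inv_of_mul_eq_one_right hone).le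
end
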